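/- arXiv:0902.0130 — 2 statements merged into one kernel-verified Lean document; each statement's English description precedes it below -/
import Mathlib

section
/- For the KKM potential V_I, the integrals satisfy the vanishing Poisson bracket relations {A₁,A₂} = {A₁,B₂} = {A₂,B₁} = {B₁,F} = {B₂,F} = 0. -/
noncomputable section

open MvPolynomial

/-- The field of rational functions over ℝ in the six variables
`x, y, z, p_x, p_y, p_z`: the fraction field of the polynomial ring. -/
abbrev K6 : Type := FractionRing (MvPolynomial (Fin 6) ℝ)

/-- The canonical embedding of the polynomial ring into its fraction field. -/
def toK6 : MvPolynomial (Fin 6) ℝ →+* K6 :=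
  algebraMap (MvPolynomial (Fin 6) ℝ) K6

/-- Constants, embedded in `K6`. -/
def cR (a : ℝ) : K6 := toK6 (MvPolynomial.C a)

def vx : K6 := toK6 (MvPolynomial.X 0)
def vy : K6 := toK6 (MvPolynomial.X 1)
def vz : K6 := toK6 (MvPolynomial.X 2)
def vpx : K6 := toK6 (MvPolynomial.X 3)
def vpy : K6 := toK6 (MvPolynomial.X 4)
def vpz : K6 := toK6 (MvPolynomial.X 5)

/-- `D` is the (unique) extension to the fraction field of the formal partial
derivative `pderiv j` on the polynomial ring: an additive map satisfying the
Leibniz rule which agrees with `pderiv j` on polynomials. -/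
def IsPDeriv (j : Fin 6) (D : K6 → K6) : Prop :=
  (∀ f g : K6, D (f + g) = D f + D g) ∧
  (∀ f g : K6, D (f * g) = D f * g + f * D g) ∧
  (∀ p, D (toK6 p) = toK6 (pderiv j p))

/-- The canonical Poisson bracket on `K6`, where `Pd 0, …, Pd 5` are the
partial derivatives with respect to `x, y, z, p_x, p_y, p_z` respectively:
`{f,g} = f_x g_{p_x} + f_y g_{p_y} + f_z g_{p_z}
  - f_{p_x} g_x - f_{p_y} g_y - f_{p_z} g_z`. -/
def poisson (Pd : Fin 6 → K6 → K6) (f g : K6) : K6 :=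
  Pd 0 f * Pd 3 g + Pd 1 f * Pd 4 g + Pd 2 f * Pd 5 g
    - Pd 3 f * Pd 0 g - Pd 4 f * Pd 1 g - Pd 5 f * Pd 2 g

/-- Angular momentum `J_x = y p_z - z p_y`. -/
def Jx : K6 := vy * vpz - vz * vpy
/-- Angular momentum `J_y = z p_x - x p_z`. -/
def Jy : K6 := vz * vpx - vx * vpz
/-- Angular momentum `J_z = x p_y - y p_x`. -/
def Jz : K6 := vx * vpy - vy * vpx
/-- Total angular momentum squared `J² = J_x² + J_y² + J_z²`. -/
def Jsq : K6 := Jx ^ 2 + Jy ^ 2 + Jz ^ 2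

/-- KKM V_I Hamiltonian. -/
def HV (α₁ α₂ α₃ δ : ℝ) : K6 :=
  vpx ^ 2 + vpy ^ 2 + vpz ^ 2 + cR δ * (vx ^ 2 + vy ^ 2 + vz ^ 2)
    + cR α₁ / vx ^ 2 + cR α₂ / vy ^ 2 + cR α₃ / vz ^ 2

def A1V (α₁ δ : ℝ) : K6 := vpx ^ 2 + cR δ * vx ^ 2 + cR α₁ / vx ^ 2

def A2V (α₃ δ : ℝ) : K6 := vpz ^ 2 + cR δ * vz ^ 2 + cR α₃ / vz ^ 2

def B1V (α₁ α₂ : ℝ) : K6 :=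
  Jz ^ 2 + cR α₂ * vx ^ 2 / vy ^ 2 + cR α₁ * vy ^ 2 / vx ^ 2

def B2V (α₂ α₃ : ℝ) : K6 :=
  Jx ^ 2 + cR α₃ * vy ^ 2 / vz ^ 2 + cR α₂ * vz ^ 2 / vy ^ 2

def FV (α₁ α₂ α₃ : ℝ) : K6 :=
  Jsq + cR α₂ * (vx ^ 2 + vz ^ 2) / vy ^ 2
    + (cR α₃ * vx ^ 2 * (vx ^ 2 + vy ^ 2) + cR α₁ * vz ^ 2 * (vy ^ 2 + vz ^ 2))
      / (vx ^ 2 * vz ^ 2)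

namespace IsPDeriv

variable {j : Fin 6} {D : K6 → K6}

theorem map_add (h : IsPDeriv j D) (f g : K6) : D (f + g) = D f + D g := h.1 f g

theorem map_mul (h : IsPDeriv j D) (f g : K6) : D (f * g) = D f * g + f * D g := h.2.1 f g

theorem map_toK6 (h : IsPDeriv j D) (p : MvPolynomial (Fin 6) ℝ) :
    D (toK6 p) = toK6 (pderiv j p) := h.2.2 p

theorem map_sub (h : IsPDeriv j D) (f g : K6) : D (f - g) = D f - D g := by
  rw [eq_sub_iff_add_eq, ← h.map_add, sub_add_cancel]

theorem map_sq (h : IsPDeriv j D) (f : K6) : D (f ^ 2) = 2 * f * D f := by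
  rw [sq, h.map_mul]
  ring

theorem map_div (h : IsPDeriv j D) (f : K6) {g : K6} (hg : g ≠ 0) :
    D (f / g) = (D f * g - f * D g) / g ^ 2 := by
  have key : D f = D (f / g) * g + f / g * D g := by
    rw [← h.map_mul, div_mul_cancel₀ f hg]
  rw [key]
  field_simp
  ring

theorem map_cR (h : IsPDeriv j D) (a : ℝ) : D (cR a) = 0 := by
  simp [cR, h.map_toK6]

theorem map_toK6_X (h : IsPDeriv j D) (i : Fin 6) :
    D (toK6 (X i)) = if i = j then 1 else 0 := by
  rw [h.map_toK6, pderiv_X, Pi.single_apply]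
  split_ifs <;> simp

end IsPDeriv

theorem toK6_X_ne_zero (i : Fin 6) : toK6 (X i) ≠ 0 :=
  (map_ne_zero_iff toK6 (IsFractionRing.injective _ K6)).2 (X_ne_zero i)

theorem kkm_VI_vanishing_brackets (α₁ α₂ α₃ δ : ℝ) (Pd : Fin 6 → K6 → K6)
    (hPd : ∀ j, IsPDeriv j (Pd j))
    (H A1 A2 B1 B2 F : K6)
    (hH : H = HV α₁ α₂ α₃ δ) (hA1 : A1 = A1V α₁ δ) (hA2 : A2 = A2V α₃ δ)
    (hB1 : B1 = B1V α₁ α₂) (hB2 : B2 = B2V α₂ α₃) (hF : F = FV α₁ α₂ α₃) :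
    poisson Pd A1 A2 = 0 ∧ poisson Pd A1 B2 = 0 ∧ poisson Pd A2 B1 = 0 ∧
      poisson Pd B1 F = 0 ∧ poisson Pd B2 F = 0 := by
  subst hH hA1 hA2 hB1 hB2 hF
  have hx : vx ≠ 0 := toK6_X_ne_zero 0
  have hy : vy ≠ 0 := toK6_X_ne_zero 1
  have hz : vz ≠ 0 := toK6_X_ne_zero 2
  have hxx : vx ^ 2 ≠ 0 := pow_ne_zero 2 hx
  have hyy : vy ^ 2 ≠ 0 := pow_ne_zero 2 hy
  have hzz : vz ^ 2 ≠ 0 := pow_ne_zero 2 hz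
  have hxz : vx ^ 2 * vz ^ 2 ≠ 0 := mul_ne_zero hxx hzz
  have dx (j) : Pd j vx = if 0 = j then 1 else 0 := (hPd j).map_toK6_X 0
  have dy (j) : Pd j vy = if 1 = j then 1 else 0 := (hPd j).map_toK6_X 1
  have dz (j) : Pd j vz = if 2 = j then 1 else 0 := (hPd j).map_toK6_X 2
  have dpx (j) : Pd j vpx = if 3 = j then 1 else 0 := (hPd j).map_toK6_X 3
  have dpy (j) : Pd j vpy = if 4 = j then 1 else 0 := (hPd j).map_toK6_X 4
  have dpz (j) : Pd j vpz = if 5 = j then 1 else 0 := (hPd j).map_toK6_X 5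
  have dc (j a) : Pd j (cR a) = 0 := (hPd j).map_cR a
  have dadd (j) := (hPd j).map_add
  have dsub (j) := (hPd j).map_sub
  have dmul (j) := (hPd j).map_mul
  have dsq (j) := (hPd j).map_sq
  have ddx (j f) := (hPd j).map_div f hxx
  have ddy (j f) := (hPd j).map_div f hyy
  have ddz (j f) := (hPd j).map_div f hzz
  have ddxz (j f) := (hPd j).map_div f hxz
  refine ⟨?_, ?_, ?_, ?_, ?_⟩ <;>
    simp only [poisson, A1V, A2V, B1V, B2V, FV, Jsq, Jx, Jy, Jz, dadd, dsub, ddx, ddy, ddz, ddxz,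
      dmul, dsq, dc, dx, dy, dz, dpx, dpy, dpz, Fin.reduceEq, reduceIte, mul_zero, zero_mul,
      add_zero, zero_add, sub_zero, zero_sub, zero_div, mul_one]
  · field_simp
    ring
  · field_simp
    ring
end
end

section
/- For the KKM potential V_I, the nested Poisson brackets involving the sixth integral F satisfy {{A₁,F},A₁} = 8A₁(A₁−H) − 16δ(B₂−F), {{A₂,F},A₂} = 8A₂(A₂−H) − 16δ(B₁−F), and {{A₁,F},A₂} = {{A₂,F},A₁} = 8A₁A₂ + 16δ(B₁+B₂−F). -/
noncomputable section

open MvPolynomial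

/-- The canonical bracket for six derivations of a field. -/
def bracket {K : Type*} [Field K] (D : Fin 6 → Derivation ℤ K K) (f g : K) : K :=
  D 0 f * D 3 g + D 1 f * D 4 g + D 2 f * D 5 g - D 3 f * D 0 g - D 4 f * D 1 g - D 5 f * D 2 g

theorem Derivation.map_ofNat_eq_zero {K : Type*} [Field K] (E : Derivation ℤ K K) (n : ℕ)
    [n.AtLeastTwo] : E (OfNat.ofNat n : K) = 0 := by
  rw [← Nat.cast_ofNat, E.map_natCast]

/-- The chain rule for an oscillator energy whose coefficients are constants of `E`. -/
theorem Derivation.map_oscillator {K : Type*} [Field K] (E : Derivation ℤ K K) {x p a d : K}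
    (ha : E a = 0) (hd : E d = 0) :
    E (p ^ 2 + d * x ^ 2 + a / x ^ 2) = 2 * p * E p + 2 * (d * x - a / x ^ 3) * E x := by
  by_cases hx : x = 0
  · simp [hx, Derivation.leibniz_pow]
    ring
  · simp only [div_eq_mul_inv, map_add, Derivation.leibniz, Derivation.leibniz_inv,
      Derivation.leibniz_pow, ha, hd, smul_eq_mul, nsmul_eq_mul]
    field_simp
    push_cast
    ring

theorem bracket_skew {K : Type*} [Field K] (D : Fin 6 → Derivation ℤ K K) (f g : K) :
    bracket D f g = -bracket D g f := by
  unfold bracket; ring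

/-- The derivations `D` with those along `x, z` and along their momenta interchanged. -/
def swapXZ {K : Type*} [Field K] (D : Fin 6 → Derivation ℤ K K) : Fin 6 → Derivation ℤ K K :=
  fun j => D (![2, 1, 0, 5, 4, 3] j)

theorem bracket_swap {K : Type*} [Field K] (D : Fin 6 → Derivation ℤ K K) (f g : K) :
    bracket (swapXZ D) f g = bracket D f g := by
  simp only [bracket, swapXZ, Matrix.cons_val]
  ring

/-- The sixth integral, over an arbitrary field. -/
def sixthIntegral {K : Type*} [Field K] (x y z p q r a b c : K) : K :=
  (y * r - z * q) ^ 2 + (z * p - x * r) ^ 2 + (x * q - y * p) ^ 2 + b * (x ^ 2 + z ^ 2) / y ^ 2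
    + (c * x ^ 2 * (x ^ 2 + y ^ 2) + a * z ^ 2 * (y ^ 2 + z ^ 2)) / (x ^ 2 * z ^ 2)

theorem sixthIntegral_swap {K : Type*} [Field K] (x y z p q r a b c : K) :
    sixthIntegral z y x r q p c b a = sixthIntegral x y z p q r a b c := by
  unfold sixthIntegral
  ring

theorem Derivation.map_sixthIntegral {K : Type*} [Field K] (E : Derivation ℤ K K)
    {x y z p q r a b c : K} (hx : x ≠ 0) (hy : y ≠ 0) (hz : z ≠ 0)
    (ha : E a = 0) (hb : E b = 0) (hc : E c = 0) :
    E (sixthIntegral x y z p q r a b c) =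
      2 * (y * r - z * q) * (E y * r + y * E r - E z * q - z * E q)
      + 2 * (z * p - x * r) * (E z * p + z * E p - E x * r - x * E r)
      + 2 * (x * q - y * p) * (E x * q + x * E q - E y * p - y * E p)
      + 2 * b * (x * E x + z * E z) / y ^ 2 - 2 * b * (x ^ 2 + z ^ 2) * E y / y ^ 3
      + 2 * c * (x * E x + y * E y) / z ^ 2 - 2 * c * (x ^ 2 + y ^ 2) * E z / z ^ 3
      + 2 * a * (y * E y + z * E z) / x ^ 2 - 2 * a * (y ^ 2 + z ^ 2) * E x / x ^ 3 := by
  simp only [sixthIntegral, div_eq_mul_inv, map_add, map_sub, Derivation.leibniz,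
    Derivation.leibniz_inv, Derivation.leibniz_pow, ha, hb, hc, smul_eq_mul, nsmul_eq_mul]
  field_simp
  push_cast
  ring

/-- Six derivations acting on `x, y, z, p, q, r` as the coordinate partial derivatives. -/
structure IsCanonical {K : Type*} [Field K] (D : Fin 6 → Derivation ℤ K K)
    (x y z p q r : K) : Prop where
  apply_x : ∀ j, D j x = if j = 0 then 1 else 0
  apply_y : ∀ j, D j y = if j = 1 then 1 else 0
  apply_z : ∀ j, D j z = if j = 2 then 1 else 0
  apply_p : ∀ j, D j p = if j = 3 then 1 else 0
  apply_q : ∀ j, D j q = if j = 4 then 1 else 0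
  apply_r : ∀ j, D j r = if j = 5 then 1 else 0

namespace IsCanonical

variable {K : Type*} [Field K] {D : Fin 6 → Derivation ℤ K K} {x y z p q r a b c d : K}

theorem bracket_oscillator_x (h : IsCanonical D x y z p q r) (ha : ∀ j, D j a = 0)
    (hd : ∀ j, D j d = 0) (f : K) :
    bracket D f (p ^ 2 + d * x ^ 2 + a / x ^ 2)
      = 2 * p * D 0 f - 2 * (d * x - a / x ^ 3) * D 3 f := by
  simp [bracket, Derivation.map_oscillator, ha, hd, h.apply_x, h.apply_p]
  ring

/-- The coordinates `x` and `z` of a canonical system may be interchanged. -/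
theorem swap (h : IsCanonical D x y z p q r) : IsCanonical (swapXZ D) z y x r q p where
  apply_x j := by rw [swapXZ, h.apply_z]; fin_cases j <;> simp
  apply_y j := by rw [swapXZ, h.apply_y]; fin_cases j <;> simp
  apply_z j := by rw [swapXZ, h.apply_x]; fin_cases j <;> simp
  apply_p j := by rw [swapXZ, h.apply_r]; fin_cases j <;> simp
  apply_q j := by rw [swapXZ, h.apply_q]; fin_cases j <;> simp
  apply_r j := by rw [swapXZ, h.apply_p]; fin_cases j <;> simp

theorem bracket_oscillator_z (h : IsCanonical D x y z p q r) (hc : ∀ j, D j c = 0)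
    (hd : ∀ j, D j d = 0) (f : K) :
    bracket D f (r ^ 2 + d * z ^ 2 + c / z ^ 2)
      = 2 * r * D 2 f - 2 * (d * z - c / z ^ 3) * D 5 f := by
  rw [← bracket_swap]
  exact h.swap.bracket_oscillator_x (fun _ => hc _) (fun _ => hd _) f

theorem x_ne_zero (h : IsCanonical D x y z p q r) : x ≠ 0 := by
  rintro rfl; simpa using h.apply_x 0

theorem y_ne_zero (h : IsCanonical D x y z p q r) : y ≠ 0 := by
  rintro rfl; simpa using h.apply_y 1

theorem z_ne_zero (h : IsCanonical D x y z p q r) : z ≠ 0 :=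
  h.swap.x_ne_zero

theorem bracket_x_sixthIntegral (h : IsCanonical D x y z p q r)
    (ha : ∀ j, D j a = 0) (hb : ∀ j, D j b = 0) (hc : ∀ j, D j c = 0) (hd : ∀ j, D j d = 0) :
    bracket D (p ^ 2 + d * x ^ 2 + a / x ^ 2) (sixthIntegral x y z p q r a b c) =
      -2 * p * (2 * q * (x * q - y * p) - 2 * r * (z * p - x * r)
          + 2 * b * x / y ^ 2 + 2 * c * x / z ^ 2 - 2 * a * (y ^ 2 + z ^ 2) / x ^ 3)
        + 4 * (d * x - a / x ^ 3) * (z * (z * p - x * r) - y * (x * q - y * p)) := by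
  have hx := h.x_ne_zero
  have hy := h.y_ne_zero
  have hz := h.z_ne_zero
  rw [bracket_skew, h.bracket_oscillator_x ha hd]
  simp only [Derivation.map_sixthIntegral _ hx hy hz (ha _) (hb _) (hc _), h.apply_x, h.apply_y,
    h.apply_z, h.apply_p, h.apply_q, h.apply_r]
  simp
  field_simp
  ring

theorem bracket_x_sixthIntegral_x (h : IsCanonical D x y z p q r)
    (ha : ∀ j, D j a = 0) (hb : ∀ j, D j b = 0) (hc : ∀ j, D j c = 0) (hd : ∀ j, D j d = 0) :
    bracket D (bracket D (p ^ 2 + d * x ^ 2 + a / x ^ 2) (sixthIntegral x y z p q r a b c))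
        (p ^ 2 + d * x ^ 2 + a / x ^ 2) =
      8 * (p ^ 2 + d * x ^ 2 + a / x ^ 2) * ((p ^ 2 + d * x ^ 2 + a / x ^ 2)
          - (p ^ 2 + q ^ 2 + r ^ 2 + d * (x ^ 2 + y ^ 2 + z ^ 2)
            + a / x ^ 2 + b / y ^ 2 + c / z ^ 2))
        - 16 * d * ((y * r - z * q) ^ 2 + c * y ^ 2 / z ^ 2 + b * z ^ 2 / y ^ 2
          - sixthIntegral x y z p q r a b c) := by
  have hx := h.x_ne_zero
  have hy := h.y_ne_zero
  have hz := h.z_ne_zero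
  have h2 (j : Fin 6) : D j (2 : K) = 0 := (D j).map_ofNat_eq_zero 2
  have h4 (j : Fin 6) : D j (4 : K) = 0 := (D j).map_ofNat_eq_zero 4
  rw [h.bracket_x_sixthIntegral ha hb hc hd, h.bracket_oscillator_x ha hd]
  simp only [div_eq_mul_inv, map_add, map_sub, map_neg, Derivation.leibniz, Derivation.leibniz_inv,
    Derivation.leibniz_pow, h2, h4, ha, hb, hc, hd, h.apply_x, h.apply_y, h.apply_z,
    h.apply_p, h.apply_q, h.apply_r, smul_eq_mul, nsmul_eq_mul, sixthIntegral]
  simp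
  field_simp
  ring

theorem bracket_x_sixthIntegral_z (h : IsCanonical D x y z p q r)
    (ha : ∀ j, D j a = 0) (hb : ∀ j, D j b = 0) (hc : ∀ j, D j c = 0) (hd : ∀ j, D j d = 0) :
    bracket D (bracket D (p ^ 2 + d * x ^ 2 + a / x ^ 2) (sixthIntegral x y z p q r a b c))
        (r ^ 2 + d * z ^ 2 + c / z ^ 2) =
      8 * (p ^ 2 + d * x ^ 2 + a / x ^ 2) * (r ^ 2 + d * z ^ 2 + c / z ^ 2)
        + 16 * d * ((x * q - y * p) ^ 2 + b * x ^ 2 / y ^ 2 + a * y ^ 2 / x ^ 2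
          + ((y * r - z * q) ^ 2 + c * y ^ 2 / z ^ 2 + b * z ^ 2 / y ^ 2)
          - sixthIntegral x y z p q r a b c) := by
  have hx := h.x_ne_zero
  have hy := h.y_ne_zero
  have hz := h.z_ne_zero
  have h2 (j : Fin 6) : D j (2 : K) = 0 := (D j).map_ofNat_eq_zero 2
  have h4 (j : Fin 6) : D j (4 : K) = 0 := (D j).map_ofNat_eq_zero 4
  rw [h.bracket_x_sixthIntegral ha hb hc hd, h.bracket_oscillator_z hc hd]
  simp only [div_eq_mul_inv, map_add, map_sub, map_neg, Derivation.leibniz, Derivation.leibniz_inv,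
    Derivation.leibniz_pow, h2, h4, ha, hb, hc, hd, h.apply_x, h.apply_y, h.apply_z,
    h.apply_p, h.apply_q, h.apply_r, smul_eq_mul, nsmul_eq_mul, sixthIntegral]
  simp
  field_simp
  ring

theorem bracket_z_sixthIntegral_x (h : IsCanonical D x y z p q r)
    (ha : ∀ j, D j a = 0) (hb : ∀ j, D j b = 0) (hc : ∀ j, D j c = 0) (hd : ∀ j, D j d = 0) :
    bracket D (bracket D (r ^ 2 + d * z ^ 2 + c / z ^ 2) (sixthIntegral x y z p q r a b c))
        (p ^ 2 + d * x ^ 2 + a / x ^ 2) =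
      8 * (p ^ 2 + d * x ^ 2 + a / x ^ 2) * (r ^ 2 + d * z ^ 2 + c / z ^ 2)
        + 16 * d * ((x * q - y * p) ^ 2 + b * x ^ 2 / y ^ 2 + a * y ^ 2 / x ^ 2
          + ((y * r - z * q) ^ 2 + c * y ^ 2 / z ^ 2 + b * z ^ 2 / y ^ 2)
          - sixthIntegral x y z p q r a b c) := by
  have hxz := h.swap.bracket_x_sixthIntegral_z (fun _ => hc _) (fun _ => hb _) (fun _ => ha _)
    (fun _ => hd _)
  rw [sixthIntegral_swap, bracket_swap, bracket_swap] at hxz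
  rw [hxz]
  ring

theorem bracket_z_sixthIntegral_z (h : IsCanonical D x y z p q r)
    (ha : ∀ j, D j a = 0) (hb : ∀ j, D j b = 0) (hc : ∀ j, D j c = 0) (hd : ∀ j, D j d = 0) :
    bracket D (bracket D (r ^ 2 + d * z ^ 2 + c / z ^ 2) (sixthIntegral x y z p q r a b c))
        (r ^ 2 + d * z ^ 2 + c / z ^ 2) =
      8 * (r ^ 2 + d * z ^ 2 + c / z ^ 2) * ((r ^ 2 + d * z ^ 2 + c / z ^ 2)
          - (p ^ 2 + q ^ 2 + r ^ 2 + d * (x ^ 2 + y ^ 2 + z ^ 2)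
            + a / x ^ 2 + b / y ^ 2 + c / z ^ 2))
        - 16 * d * ((x * q - y * p) ^ 2 + b * x ^ 2 / y ^ 2 + a * y ^ 2 / x ^ 2
          - sixthIntegral x y z p q r a b c) := by
  have hxx := h.swap.bracket_x_sixthIntegral_x (fun _ => hc _) (fun _ => hb _) (fun _ => ha _)
    (fun _ => hd _)
  rw [sixthIntegral_swap, bracket_swap, bracket_swap] at hxx
  rw [hxx]
  ring

end IsCanonical

/-- An additive map of a field satisfying the Leibniz rule, as a derivation. -/
def derivationOfLeibniz {K : Type*} [Field K] (E : K → K) (hadd : ∀ f g, E (f + g) = E f + E g)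
    (hmul : ∀ f g, E (f * g) = E f * g + f * E g) : Derivation ℤ K K :=
  Derivation.mk' { AddMonoidHom.mk' E hadd with map_smul' := map_zsmul (AddMonoidHom.mk' E hadd) }
    fun f g => by
      change E (f * g) = f * E g + g * E f
      rw [hmul]; ring

/-- A map satisfying `IsPDeriv`, as a derivation. -/
def IsPDeriv.toDerivation {j : Fin 6} {E : K6 → K6} (h : IsPDeriv j E) :=
  derivationOfLeibniz E h.1 h.2.1

theorem IsPDeriv.toDerivation_toK6 {j : Fin 6} {E : K6 → K6} (h : IsPDeriv j E)
    (f : MvPolynomial (Fin 6) ℝ) : h.toDerivation (toK6 f) = toK6 (pderiv j f) :=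
  h.2.2 f

theorem IsPDeriv.toDerivation_cR {j : Fin 6} {E : K6 → K6} (h : IsPDeriv j E) (a : ℝ) :
    h.toDerivation (cR a) = 0 := by
  rw [cR, h.toDerivation_toK6, pderiv_C, map_zero]

theorem IsPDeriv.toDerivation_X {j : Fin 6} {E : K6 → K6} (h : IsPDeriv j E) (i : Fin 6) :
    h.toDerivation (toK6 (X i)) = if j = i then 1 else 0 := by
  rw [h.toDerivation_toK6]
  split_ifs with hij
  · rw [hij, pderiv_X_self, map_one]
  · rw [pderiv_X_of_ne (Ne.symm hij), map_zero]

theorem isCanonical_toDerivation {Pd : Fin 6 → K6 → K6} (hPd : ∀ j, IsPDeriv j (Pd j)) :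
    IsCanonical (fun j => (hPd j).toDerivation) vx vy vz vpx vpy vpz where
  apply_x j := (hPd j).toDerivation_X 0
  apply_y j := (hPd j).toDerivation_X 1
  apply_z j := (hPd j).toDerivation_X 2
  apply_p j := (hPd j).toDerivation_X 3
  apply_q j := (hPd j).toDerivation_X 4
  apply_r j := (hPd j).toDerivation_X 5

theorem kkm_VI_nested_F (α₁ α₂ α₃ δ : ℝ) (Pd : Fin 6 → K6 → K6)
    (hPd : ∀ j, IsPDeriv j (Pd j))
    (H A1 A2 B1 B2 F : K6)
    (hH : H = HV α₁ α₂ α₃ δ) (hA1 : A1 = A1V α₁ δ) (hA2 : A2 = A2V α₃ δ)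
    (hB1 : B1 = B1V α₁ α₂) (hB2 : B2 = B2V α₂ α₃) (hF : F = FV α₁ α₂ α₃) :
    poisson Pd (poisson Pd A1 F) A1 = 8 * A1 * (A1 - H) - 16 * cR δ * (B2 - F) ∧
    poisson Pd (poisson Pd A2 F) A2 = 8 * A2 * (A2 - H) - 16 * cR δ * (B1 - F) ∧
    poisson Pd (poisson Pd A1 F) A2 = 8 * A1 * A2 + 16 * cR δ * (B1 + B2 - F) ∧
    poisson Pd (poisson Pd A2 F) A1 = 8 * A1 * A2 + 16 * cR δ * (B1 + B2 - F) := by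
  subst hH hA1 hA2 hB1 hB2 hF
  have h := isCanonical_toDerivation hPd
  have hconst (a : ℝ) (j : Fin 6) : (hPd j).toDerivation (cR a) = 0 := (hPd j).toDerivation_cR a
  have ha := hconst α₁
  have hb := hconst α₂
  have hc := hconst α₃
  have hd := hconst δ
  refine ⟨h.bracket_x_sixthIntegral_x ha hb hc hd, h.bracket_z_sixthIntegral_z ha hb hc hd, ?_, ?_⟩
  · exact h.bracket_x_sixthIntegral_z ha hb hc hd
  · exact h.bracket_z_sixthIntegral_x ha hb hc hd
end
end
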